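/- In the abelian group G = ℤ/17 × ℤ/17 (of order 289), the four 9-element subsets B₁ = {(0,0),(0,1),(0,3),(1,3),(2,2),(3,3),(4,10),(6,16),(10,14)}, B₂ = {(0,0),(0,4),(0,9),(1,15),(5,9),(9,13),(10,8),(11,16),(13,9)}, B₃ = {(0,0),(0,6),(2,15),(3,11),(5,8),(10,9),(11,14),(13,1),(14,11)}, B₄ = {(0,0),(0,7),(1,4),(3,15),(5,10),(6,2),(8,9),(10,5),(12,10)} form a (289,9,1)-difference family: every nonzero element g of G has exactly one representation g = x − y with x, y belonging to the same block Bᵢ. -/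

import Mathlib

def B9 : Fin 4 → Finset (ZMod 17 × ZMod 17) :=
  ![({(0, 0), (0, 1), (0, 3), (1, 3), (2, 2), (3, 3), (4, 10), (6, 16), (10, 14)} : Finset (ZMod 17 × ZMod 17)),
    ({(0, 0), (0, 4), (0, 9), (1, 15), (5, 9), (9, 13), (10, 8), (11, 16), (13, 9)} : Finset (ZMod 17 × ZMod 17)),
    ({(0, 0), (0, 6), (2, 15), (3, 11), (5, 8), (10, 9), (11, 14), (13, 1), (14, 11)} : Finset (ZMod 17 × ZMod 17)),
    ({(0, 0), (0, 7), (1, 4), (3, 15), (5, 10), (6, 2), (8, 9), (10, 5), (12, 10)} : Finset (ZMod 17 × ZMod 17))]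

theorem B9_card (i : Fin 4) : (B9 i).card = 9 := by
  revert i
  decide +kernel

theorem testBit_fold_lor {α : Type*} (s : Finset α) (f : α → ℕ) (k : ℕ) :
    (s.fold (fun m n : ℕ => m ||| n) 0 f).testBit k = true ↔ ∃ x ∈ s, (f x).testBit k = true := by
  classical
  induction s using Finset.induction_on with
  | empty => simp
  | insert a s ha ih => simp [Finset.fold_insert ha, Nat.testBit_or, ih]

/-- The position of an element of the group in the lexicographic order. -/
def lexIndex (g : ZMod 17 × ZMod 17) : ℕ := 17 * g.1.val + g.2.val

theorem lexIndex_lt (g : ZMod 17 × ZMod 17) : lexIndex g < 289 := by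
  have h₁ := g.1.val_lt
  have h₂ := g.2.val_lt
  unfold lexIndex
  omega

theorem lexIndex_injective : Function.Injective lexIndex := by
  intro g h hgh
  have h₁ := g.2.val_lt
  have h₂ := h.2.val_lt
  unfold lexIndex at hgh
  exact Prod.ext (ZMod.val_injective 17 (by omega)) (ZMod.val_injective 17 (by omega))

/-- The differences within blocks, recorded as the set bits of a natural number, fill
all 289 positions. -/
theorem fold_differences :
    (Finset.univ : Finset (Fin 4)).fold (fun m n : ℕ => m ||| n) 0 (fun i =>
      (B9 i ×ˢ B9 i).fold (fun m n : ℕ => m ||| n) 0 fun p => 2 ^ lexIndex (p.1 - p.2)) = 2 ^ 289 - 1 := by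
  decide +kernel

theorem exists_add_mem_B9 (g : ZMod 17 × ZMod 17) : ∃ i, ∃ y ∈ B9 i, g + y ∈ B9 i := by
  have h : (2 ^ 289 - 1).testBit (lexIndex g) = true := by
    rw [Nat.testBit_two_pow_sub_one]
    exact decide_eq_true (lexIndex_lt g)
  rw [← fold_differences, testBit_fold_lor] at h
  obtain ⟨i, -, h⟩ := h
  obtain ⟨⟨x, y⟩, hxy, h⟩ := (testBit_fold_lor _ _ _).1 h
  rw [Finset.mem_product] at hxy
  rw [Nat.testBit_two_pow, decide_eq_true_iff] at h
  refine ⟨i, y, hxy.2, ?_⟩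
  rw [← lexIndex_injective h, sub_add_cancel]
  exact hxy.1

/-- The ordered pairs of distinct elements of a common block, tagged with the block. -/
def blockPairs : Finset (Fin 4 × (ZMod 17 × ZMod 17) × (ZMod 17 × ZMod 17)) :=
  Finset.univ.biUnion fun i => (B9 i).offDiag.map ⟨Prod.mk i, Prod.mk_right_injective i⟩

theorem mem_blockPairs {t : Fin 4 × (ZMod 17 × ZMod 17) × (ZMod 17 × ZMod 17)} :
    t ∈ blockPairs ↔ t.2.1 ∈ B9 t.1 ∧ t.2.2 ∈ B9 t.1 ∧ t.2.1 ≠ t.2.2 := by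
  obtain ⟨i, x, y⟩ := t
  simp [blockPairs]

theorem card_blockPairs : blockPairs.card = 288 := by
  rw [blockPairs, Finset.card_biUnion]
  · simp [Finset.offDiag_card, B9_card]
  · intro i _ j _ hij
    simp only [Function.onFun, Finset.disjoint_left, Finset.mem_map, Function.Embedding.coeFn_mk]
    rintro _ ⟨a, _, rfl⟩ ⟨b, _, h⟩
    exact hij (congrArg Prod.fst h).symm

theorem blockPairs_sub_injOn :
    Set.InjOn (fun t : Fin 4 × (ZMod 17 × ZMod 17) × (ZMod 17 × ZMod 17) => t.2.1 - t.2.2)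
      blockPairs := by
  refine Finset.injOn_of_surjOn_of_card_le (t := Finset.univ.erase 0) _ ?_ ?_ ?_
  · intro t ht
    simpa [sub_eq_zero] using (mem_blockPairs.1 ht).2.2
  · intro g hg
    obtain ⟨i, y, hy, hx⟩ := exists_add_mem_B9 g
    refine ⟨(i, g + y, y), mem_blockPairs.2 ⟨hx, hy, ?_⟩, add_sub_cancel_right g y⟩
    simpa using hg
  · rw [card_blockPairs, Finset.card_erase_of_mem (Finset.mem_univ _), Finset.card_univ,
      Fintype.card_prod, ZMod.card]

theorem stmt_9 :
    (∀ i : Fin 4, (B9 i).card = 9) ∧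
    ∀ g : ZMod 17 × ZMod 17, g ≠ 0 →
      ∃! t : Fin 4 × (ZMod 17 × ZMod 17) × (ZMod 17 × ZMod 17),
        t.2.1 ∈ B9 t.1 ∧ t.2.2 ∈ B9 t.1 ∧ t.2.1 - t.2.2 = g := by
  refine ⟨B9_card, fun g hg => ?_⟩
  obtain ⟨i, y, hy, hx⟩ := exists_add_mem_B9 g
  refine ⟨(i, g + y, y), ⟨hx, hy, add_sub_cancel_right g y⟩, ?_⟩
  rintro t ⟨htx, hty, ht⟩
  refine blockPairs_sub_injOn (mem_blockPairs.2 ⟨htx, hty, ?_⟩)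
    (mem_blockPairs.2 ⟨hx, hy, ?_⟩) ?_
  · rwa [← sub_ne_zero, ht]
  · simpa using hg
  · simpa using ht
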